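/- arXiv:1912.07140 — 6 statements merged into one kernel-verified Lean document; each statement's English description precedes it below -/
import Mathlib

section
/- A homeomorphism g of [0,1] belongs to Thompson's group F if and only if there exist n ≥ 1 and two standard dyadic partitions 0 = x₀ < x₁ < ... < xₙ = 1 and 0 = y₀ < y₁ < ... < yₙ = 1 of [0,1] such that for every i ∈ {1,...,n}, g maps [x_{i-1}, x_i] onto [y_{i-1}, y_i] by the unique increasing affine map between these intervals. -/
/-- A dyadic rational: a number of the form `a / 2 ^ b` with `a, b` integers. -/
def IsDyadic (x : ℝ) : Prop := ∃ (a : ℤ) (b : ℕ), x = (a : ℝ) / 2 ^ b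

/-- Extend a self-map of `[0,1]` to a map `ℝ → ℝ` (by the identity outside `[0,1]`). -/
noncomputable def extIcc (g : Set.Icc (0:ℝ) 1 → Set.Icc (0:ℝ) 1) : ℝ → ℝ :=
  fun x => if hx : x ∈ Set.Icc (0:ℝ) 1 then (g ⟨x, hx⟩ : ℝ) else x

/-- Membership in Thompson's group `F`: piecewise linear with finitely many breakpoints,
all breakpoints at dyadic rationals, all slopes integer powers of `2`. -/
def IsPLThompson (f : ℝ → ℝ) : Prop :=
  ∃ (n : ℕ) (x : Fin (n + 1) → ℝ),
    x 0 = 0 ∧ x (Fin.last n) = 1 ∧ StrictMono x ∧ (∀ i, IsDyadic (x i)) ∧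
    ∀ i : Fin n, ∃ (k : ℤ) (c : ℝ),
      ∀ t ∈ Set.Icc (x i.castSucc) (x i.succ), f t = (2 : ℝ) ^ k * t + c

/-- `[a,b]` is a standard dyadic interval `[k/2^m, (k+1)/2^m] ⊆ [0,1]`. -/
def IsStdDyadicInterval (a b : ℝ) : Prop :=
  ∃ (k m : ℕ), a = (k : ℝ) / 2 ^ m ∧ b = ((k : ℝ) + 1) / 2 ^ m ∧ b ≤ 1

/-- A standard dyadic partition `0 = x₀ < x₁ < ⋯ < xₙ = 1` of `[0,1]`. -/
def IsStdDyadicPartition {n : ℕ} (x : Fin (n + 1) → ℝ) : Prop :=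
  x 0 = 0 ∧ x (Fin.last n) = 1 ∧ StrictMono x ∧
  ∀ i : Fin n, IsStdDyadicInterval (x i.castSucc) (x i.succ)

/-- `f` maps `[a,b]` onto `[a',b']` by the unique increasing affine map between them. -/
def AffineUpOn (f : ℝ → ℝ) (a b a' b' : ℝ) : Prop :=
  ∀ t ∈ Set.Icc a b, f t = a' + ((b' - a') / (b - a)) * (t - a)

namespace IsDyadic

lemma zero : IsDyadic 0 := ⟨0, 0, by simp⟩

lemma add {x y : ℝ} (hx : IsDyadic x) (hy : IsDyadic y) : IsDyadic (x + y) := by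
  obtain ⟨a, b, rfl⟩ := hx
  obtain ⟨c, d, rfl⟩ := hy
  refine ⟨a * 2 ^ d + c * 2 ^ b, b + d, ?_⟩
  push_cast
  field_simp
  ring

lemma neg {x : ℝ} (hx : IsDyadic x) : IsDyadic (-x) := by
  obtain ⟨a, b, rfl⟩ := hx
  exact ⟨-a, b, by push_cast; ring⟩

lemma mul {x y : ℝ} (hx : IsDyadic x) (hy : IsDyadic y) : IsDyadic (x * y) := by
  obtain ⟨a, b, rfl⟩ := hx
  obtain ⟨c, d, rfl⟩ := hy
  refine ⟨a * c, b + d, ?_⟩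
  push_cast
  field_simp
  ring

lemma two_zpow (k : ℤ) : IsDyadic ((2 : ℝ) ^ k) := by
  obtain ⟨m, rfl | rfl⟩ := k.eq_nat_or_neg
  · exact ⟨2 ^ m, 0, by simp⟩
  · exact ⟨1, m, by simp⟩

/-- A dyadic rational can be written with denominator `2 ^ (M - k)` for all large `M`. -/
lemma eventually_eq_div {x : ℝ} (hx : IsDyadic x) (k : ℤ) :
    ∀ᶠ M : ℕ in Filter.atTop, ∃ (m : ℕ) (a : ℤ), (m : ℤ) = M - k ∧ x = (a : ℝ) / 2 ^ m := by
  obtain ⟨a, b, rfl⟩ := hx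
  filter_upwards [Filter.eventually_ge_atTop (b + k.natAbs)] with M hM
  obtain ⟨d, hd⟩ : ∃ d : ℕ, ((b + d : ℕ) : ℤ) = M - k :=
    ⟨((M : ℤ) - k - b).toNat, by omega⟩
  refine ⟨b + d, a * 2 ^ d, hd, ?_⟩
  push_cast
  field_simp
  ring

end IsDyadic

/-- A point between the first and the last value of a finite sequence lies between two
consecutive values. -/
lemma exists_castSucc_le_lt_succ {n : ℕ} (x : Fin (n + 1) → ℝ) {t : ℝ} (h0 : x 0 ≤ t)
    (h1 : t < x (Fin.last n)) : ∃ i : Fin n, x i.castSucc ≤ t ∧ t < x i.succ := by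
  by_contra! h
  exact h1.not_ge (Fin.induction (motive := fun i => x i ≤ t) h0 h (Fin.last n))

lemma extIcc_mem_Icc (g : Set.Icc (0:ℝ) 1 → Set.Icc (0:ℝ) 1) {t : ℝ}
    (ht : t ∈ Set.Icc (0:ℝ) 1) : extIcc g t ∈ Set.Icc (0:ℝ) 1 := by
  rw [extIcc, dif_pos ht]
  exact (g ⟨t, ht⟩).2

lemma exists_extIcc_eq {g : Set.Icc (0:ℝ) 1 → Set.Icc (0:ℝ) 1} (hg : Function.Surjective g)
    {s : ℝ} (hs : s ∈ Set.Icc (0:ℝ) 1) : ∃ t ∈ Set.Icc (0:ℝ) 1, extIcc g t = s := by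
  obtain ⟨t, ht⟩ := hg ⟨s, hs⟩
  exact ⟨t, t.2, by rw [extIcc, dif_pos t.2, ht]⟩

/-- A function that is increasing on each piece of a partition attains its extreme values at
the end points. -/
lemma mem_Icc_of_piecewise_monotoneOn {f : ℝ → ℝ} {n : ℕ} {x : Fin (n + 1) → ℝ}
    (hx : StrictMono x)
    (hf : ∀ i : Fin n, MonotoneOn f (Set.Icc (x i.castSucc) (x i.succ))) {t : ℝ}
    (ht : t ∈ Set.Icc (x 0) (x (Fin.last n))) :
    f t ∈ Set.Icc (f (x 0)) (f (x (Fin.last n))) := by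
  have hle (i : Fin n) : x i.castSucc ≤ x i.succ := (hx i.castSucc_lt_succ).le
  have hmono : Monotone (f ∘ x) := Fin.monotone_iff_le_succ.2 fun i =>
    hf i (Set.left_mem_Icc.2 (hle i)) (Set.right_mem_Icc.2 (hle i)) (hle i)
  rcases ht.2.eq_or_lt with rfl | hlt
  · exact ⟨hmono (Fin.zero_le _), le_rfl⟩
  · obtain ⟨i, hi, hi'⟩ := exists_castSucc_le_lt_succ x ht.1 hlt
    exact ⟨(hmono (Fin.zero_le i.castSucc)).trans
        (hf i (Set.left_mem_Icc.2 (hle i)) ⟨hi, hi'.le⟩ hi),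
      (hf i ⟨hi, hi'.le⟩ (Set.right_mem_Icc.2 (hle i)) hi'.le).trans
        (hmono (Fin.le_last i.succ))⟩

lemma IsStdDyadicInterval.isDyadic_left {a b : ℝ} (h : IsStdDyadicInterval a b) :
    IsDyadic a := by
  obtain ⟨k, m, rfl, -, -⟩ := h
  exact ⟨k, m, by simp⟩

lemma IsStdDyadicInterval.exists_sub_eq {a b : ℝ} (h : IsStdDyadicInterval a b) :
    ∃ m : ℤ, b - a = (2 : ℝ) ^ m := by
  obtain ⟨k, m, rfl, rfl, -⟩ := h
  refine ⟨-m, ?_⟩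
  rw [zpow_neg, zpow_natCast]
  ring

lemma IsStdDyadicPartition.isDyadic {n : ℕ} {x : Fin (n + 1) → ℝ}
    (hx : IsStdDyadicPartition x) (i : Fin (n + 1)) : IsDyadic (x i) := by
  induction i using Fin.lastCases with
  | last => exact ⟨1, 0, by simp [hx.2.1]⟩
  | cast i => exact (hx.2.2.2 i).isDyadic_left

/-- A function that is affine between corresponding intervals of two standard dyadic partitions
is piecewise linear with dyadic breakpoints and slopes powers of `2`. -/
lemma isPLThompson_of_affineUpOn {f : ℝ → ℝ} {n : ℕ} {x y : Fin (n + 1) → ℝ}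
    (hx : IsStdDyadicPartition x) (hy : IsStdDyadicPartition y)
    (hf : ∀ i : Fin n, AffineUpOn f (x i.castSucc) (x i.succ) (y i.castSucc) (y i.succ)) :
    IsPLThompson f := by
  refine ⟨n, x, hx.1, hx.2.1, hx.2.2.1, hx.isDyadic, fun i => ?_⟩
  obtain ⟨p, hp⟩ := (hx.2.2.2 i).exists_sub_eq
  obtain ⟨q, hq⟩ := (hy.2.2.2 i).exists_sub_eq
  refine ⟨q - p, y i.castSucc - 2 ^ (q - p) * x i.castSucc, fun t ht => ?_⟩
  rw [hf i t ht, hp, hq, zpow_sub₀ two_ne_zero]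
  ring

/-- A piecewise linear surjection of `[0,1]` with dyadic breakpoints and slopes powers of `2`
maps the intervals of every sufficiently fine uniform dyadic partition affinely onto standard
dyadic intervals. -/
lemma IsPLThompson.exists_partitions {g : Set.Icc (0:ℝ) 1 → Set.Icc (0:ℝ) 1}
    (hg : Function.Surjective g) (h : IsPLThompson (extIcc g)) :
    ∃ n : ℕ, 1 ≤ n ∧ ∃ (x y : Fin (n + 1) → ℝ),
      IsStdDyadicPartition x ∧ IsStdDyadicPartition y ∧
      ∀ i : Fin n,
        AffineUpOn (extIcc g) (x i.castSucc) (x i.succ) (y i.castSucc) (y i.succ) := by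
  obtain ⟨n, x, hx0, hx1, hx, hxd, hf⟩ := h
  choose k c hf using hf
  set f := extIcc g
  have hle (i : Fin n) : x i.castSucc ≤ x i.succ := (hx i.castSucc_lt_succ).le
  have hext {t : ℝ} (ht : t ∈ Set.Icc (0:ℝ) 1) : f t ∈ Set.Icc (f 0) (f 1) := by
    rw [← hx0, ← hx1] at ht ⊢
    refine mem_Icc_of_piecewise_monotoneOn hx (fun i s hs t ht hst => ?_) ht
    rw [hf i s hs, hf i t ht]
    gcongr
  have hf0 : f 0 = 0 := by
    obtain ⟨t, ht, hft⟩ := exists_extIcc_eq hg (Set.left_mem_Icc.2 zero_le_one)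
    exact le_antisymm (hft ▸ (hext ht).1) (extIcc_mem_Icc g (by simp)).1
  have hf1 : f 1 = 1 := by
    obtain ⟨t, ht, hft⟩ := exists_extIcc_eq hg (Set.right_mem_Icc.2 zero_le_one)
    exact le_antisymm (extIcc_mem_Icc g (by simp)).2 (hft.symm.trans_le (hext ht).2)
  have hc_of {i : Fin n} (hi : IsDyadic (f (x i.castSucc))) : IsDyadic (c i) := by
    have := hi.add ((IsDyadic.two_zpow (k i)).mul (hxd i.castSucc)).neg
    rwa [hf i _ (Set.left_mem_Icc.2 (hle i)), add_neg_eq_of_eq_add (add_comm _ _)] at this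
  have hfd (i : Fin (n + 1)) : IsDyadic (f (x i)) := by
    induction i using Fin.induction with
    | zero => rw [hx0, hf0]; exact IsDyadic.zero
    | succ i ih =>
      rw [hf i _ (Set.right_mem_Icc.2 (hle i))]
      exact ((IsDyadic.two_zpow _).mul (hxd _)).add (hc_of ih)
  obtain ⟨M, hMx, hMc⟩ :=
    ((Filter.eventually_all.2 fun i => (hxd i).eventually_eq_div 0).and
      (Filter.eventually_all.2 fun i =>
        (hc_of (hfd (Fin.castSucc i))).eventually_eq_div (k i))).exists
  have hpos : (0 : ℝ) < 2 ^ M := by positivity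
  let u (j : Fin (2 ^ M + 1)) : ℝ := (j : ℕ) / 2 ^ M
  have hu0 : u 0 = 0 := by simp [u]
  have hu1 : u (Fin.last _) = 1 := by simp [u]
  have hus (j : Fin (2 ^ M)) : u j.succ = u j.castSucc + 1 / 2 ^ M := by
    simp [u, add_div]
  have hu : StrictMono u := Fin.strictMono_iff_lt_succ.2 fun j => by
    rw [hus]; exact lt_add_of_pos_right _ (by positivity)
  have humem (j : Fin (2 ^ M + 1)) : u j ∈ Set.Icc (0:ℝ) 1 :=
    ⟨hu0 ▸ hu.monotone (Fin.zero_le j), hu1 ▸ hu.monotone (Fin.le_last j)⟩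
  have hpiece (j : Fin (2 ^ M)) : ∃ i : Fin n,
      x i.castSucc ≤ u j.castSucc ∧ u j.succ ≤ x i.succ := by
    obtain ⟨i, hi, hi'⟩ := exists_castSucc_le_lt_succ x (t := u j.castSucc)
      (hx0 ▸ (humem _).1) (hx1 ▸ hu1 ▸ hu (Fin.castSucc_lt_last j))
    refine ⟨i, hi, ?_⟩
    obtain ⟨m, a, hm, ha⟩ := hMx i.succ
    obtain rfl : m = M := by omega
    rw [ha] at hi' ⊢
    simp only [u, Fin.val_castSucc, Fin.val_succ] at hi' ⊢
    rw [div_lt_div_iff_of_pos_right hpos] at hi'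
    rw [div_le_div_iff_of_pos_right hpos]
    have : ((j : ℕ) : ℤ) < a := by exact_mod_cast hi'
    exact_mod_cast Int.add_one_le_of_lt this
  have hlocal (j : Fin (2 ^ M)) : ∃ (m : ℕ) (a : ℤ),
      f (u j.castSucc) = a / 2 ^ m ∧ f (u j.succ) = (a + 1) / 2 ^ m ∧
      ∀ t ∈ Set.Icc (u j.castSucc) (u j.succ),
        f t = f (u j.castSucc) + 2 ^ M / 2 ^ m * (t - u j.castSucc) := by
    obtain ⟨i, hi, hi'⟩ := hpiece j
    obtain ⟨m, a, hm, ha⟩ := hMc i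
    have hk : (2 : ℝ) ^ k i = 2 ^ M / 2 ^ m := by
      rw [show k i = (M : ℤ) - m by omega, zpow_sub₀ two_ne_zero, zpow_natCast, zpow_natCast]
    have hlt : u j.castSucc ≤ u j.succ := (hu j.castSucc_lt_succ).le
    have hft (t : ℝ) (ht : t ∈ Set.Icc (u j.castSucc) (u j.succ)) :
        f t = 2 ^ M / 2 ^ m * t + a / 2 ^ m := by
      rw [hf i t ⟨hi.trans ht.1, ht.2.trans hi'⟩, hk, ha]
    have hl := hft _ (Set.left_mem_Icc.2 hlt)
    have hr := hft _ (Set.right_mem_Icc.2 hlt)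
    refine ⟨m, (j : ℕ) + a, ?_, ?_, fun t ht => ?_⟩
    · rw [hl]
      simp only [u, Fin.val_castSucc]
      push_cast
      field_simp
    · rw [hr]
      simp only [u, Fin.val_succ]
      push_cast
      field_simp
      ring
    · rw [hl, hft t ht]
      ring
  refine ⟨2 ^ M, Nat.one_le_two_pow, u, f ∘ u, ⟨hu0, hu1, hu, fun j => ?_⟩,
    ⟨by simp [hu0, hf0], by simp [hu1, hf1], Fin.strictMono_iff_lt_succ.2 fun j => ?_,
      fun j => ?_⟩, fun j t ht => ?_⟩
  · exact ⟨j, M, rfl, by simp [u], (humem _).2⟩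
  · obtain ⟨m, a, hl, hr, -⟩ := hlocal j
    simp only [Function.comp_apply, hl, hr]
    gcongr
    linarith
  · obtain ⟨m, a, hl, hr, -⟩ := hlocal j
    have h0 : 0 ≤ f (u j.castSucc) := (extIcc_mem_Icc g (humem _)).1
    have ha : 0 ≤ a := by
      rw [hl, le_div_iff₀ (by positivity), zero_mul] at h0
      exact_mod_cast h0
    lift a to ℕ using ha
    exact ⟨a, m, hl, hr, (extIcc_mem_Icc g (humem _)).2⟩
  · obtain ⟨m, a, hl, hr, hft⟩ := hlocal j
    have hslope : (f (u j.succ) - f (u j.castSucc)) / (u j.succ - u j.castSucc)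
        = 2 ^ M / 2 ^ m := by
      rw [hl, hr, hus]
      field_simp
      ring
    rw [hft t ht, Function.comp_apply, Function.comp_apply, hslope]

/-- A homeomorphism `g` of `[0,1]` belongs to Thompson's group `F` iff there are `n ≥ 1`
and standard dyadic partitions `(xᵢ)`, `(yᵢ)` of `[0,1]` such that for every `i`, `g` maps
`[x_{i-1}, x_i]` onto `[y_{i-1}, y_i]` by the unique increasing affine map. -/
theorem thompsonF_iff_dyadic_partitions (g : Set.Icc (0:ℝ) 1 ≃ₜ Set.Icc (0:ℝ) 1) :
    IsPLThompson (extIcc ⇑g) ↔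
      ∃ n : ℕ, 1 ≤ n ∧ ∃ (x y : Fin (n + 1) → ℝ),
        IsStdDyadicPartition x ∧ IsStdDyadicPartition y ∧
        ∀ i : Fin n,
          AffineUpOn (extIcc ⇑g) (x i.castSucc) (x i.succ) (y i.castSucc) (y i.succ) := by
  refine ⟨fun h => h.exists_partitions g.surjective, ?_⟩
  rintro ⟨n, -, x, y, hx, hy, hf⟩
  exact isPLThompson_of_affineUpOn hx hy hf
end

section
/- If two finite rooted binary trees have the same left-to-right sequence of leaf depths (the list, read from left to right, of the distances from each leaf to the root), then the two trees are equal. -/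
/-- A finite rooted ordered binary tree: either a single leaf, or an ordered pair of
a left subtree and a right subtree. -/
inductive BinTree : Type
  | leaf : BinTree
  | node : BinTree → BinTree → BinTree

/-- The left-to-right list of the depths of the leaves of a tree (the depth of a leaf is
the number of edges from the root to the leaf). -/
def BinTree.leafDepths : BinTree → List ℕ
  | .leaf => [0]
  | .node l r => (l.leafDepths.map (· + 1)) ++ (r.leafDepths.map (· + 1))

theorem BinTree.leafDepths_ne_nil (t : BinTree) : t.leafDepths ≠ [] := by
  induction t with
  | leaf => simp [leafDepths]
  | node l r ihl _ => simp [leafDepths, ihl]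

/-- The shifted leaf depths of a non-leaf tree never start with the shift itself. -/
theorem BinTree.cons_ne_leafDepths_node_map_append (l r : BinTree) (k : ℕ) (u v : List ℕ) :
    k :: u ≠ (node l r).leafDepths.map (· + k) ++ v := by
  obtain ⟨a, d, hd⟩ := List.exists_cons_of_ne_nil l.leafDepths_ne_nil
  intro h
  simp only [leafDepths, hd, List.map_cons, List.cons_append, List.cons.injEq] at h
  omega

theorem BinTree.leafDepths_node_map_append (l r : BinTree) (k : ℕ) (u : List ℕ) :
    (node l r).leafDepths.map (· + k) ++ u =
      l.leafDepths.map (· + (k + 1)) ++ (r.leafDepths.map (· + (k + 1)) ++ u) := by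
  simp [leafDepths, Function.comp_def, Nat.add_assoc, Nat.add_comm 1 k]

/-- Leaf depth sequences form a prefix code: a tree is determined by any list that starts
with its leaf depths, shifted by a known amount. -/
theorem BinTree.eq_and_eq_of_leafDepths_map_append_eq (t s : BinTree) (k : ℕ) (u v : List ℕ)
    (h : t.leafDepths.map (· + k) ++ u = s.leafDepths.map (· + k) ++ v) : t = s ∧ u = v := by
  induction t generalizing s k u v with
  | leaf =>
    cases s with
    | leaf => simpa [leafDepths] using h
    | node l r =>
      exact absurd (by simpa [leafDepths] using h) (cons_ne_leafDepths_node_map_append l r k u v)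
  | node l r ihl ihr =>
    cases s with
    | leaf =>
      exact absurd (by simpa [leafDepths] using h.symm)
        (cons_ne_leafDepths_node_map_append l r k v u)
    | node l' r' =>
      rw [leafDepths_node_map_append, leafDepths_node_map_append] at h
      obtain ⟨rfl, hr⟩ := ihl _ _ _ _ h
      obtain ⟨rfl, huv⟩ := ihr _ _ _ _ hr
      exact ⟨rfl, huv⟩

/-- If two finite rooted binary trees have the same left-to-right sequence of leaf
depths, then they are equal. -/
theorem BinTree.eq_of_leafDepths_eq (t s : BinTree)
    (h : t.leafDepths = s.leafDepths) : t = s := by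
  exact (eq_and_eq_of_leafDepths_map_append_eq t s 0 [] [] (by simpa using h)).1
end

section
/- The map Φ sending a finite rooted binary tree to a partition of [0,1], defined inductively by sending the single leaf to the trivial partition {[0,1]} and sending the tree with left subtree t₁ and right subtree t₂ to the partition obtained by rescaling Φ(t₁) into [0,1/2] and rescaling Φ(t₂) into [1/2,1], is a bijection from the set of finite rooted binary trees onto the set of standard dyadic partitions of [0,1]. -/
/-- A finite set `S ⊆ [0,1]` is the set of partition points of a standard dyadic
partition of `[0,1]`: it contains `0` and `1` and any two consecutive points of `S`
bound a standard dyadic interval. -/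
def IsStdDyadicPartitionSet (S : Finset ℝ) : Prop :=
  (0 : ℝ) ∈ S ∧ (1 : ℝ) ∈ S ∧ (↑S : Set ℝ) ⊆ Set.Icc (0 : ℝ) 1 ∧
  ∀ a ∈ S, ∀ b ∈ S, a < b → (∀ c ∈ S, ¬(a < c ∧ c < b)) → IsStdDyadicInterval a b

/-- The map `Φ` sending a finite rooted binary tree to a partition of `[0,1]`, given by
its finite set of partition points: the single leaf goes to the trivial partition
`{[0,1]}` (partition points `{0,1}`), and the tree with subtrees `t₁`, `t₂` goes to the
partition obtained by rescaling `Φ(t₁)` into `[0,1/2]` and `Φ(t₂)` into `[1/2,1]`. -/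
noncomputable def BinTree.toPartition : BinTree → Finset ℝ
  | .leaf => {0, 1}
  | .node l r =>
      l.toPartition.image (fun x => x / 2) ∪ r.toPartition.image (fun x => (x + 1) / 2)

lemma IsStdDyadicInterval.half {a b : ℝ} (h : IsStdDyadicInterval a b) :
    IsStdDyadicInterval (a / 2) (b / 2) := by
  obtain ⟨k, m, rfl, rfl, hb⟩ := h
  refine ⟨k, m + 1, ?_, ?_, by linarith⟩ <;> rw [pow_succ] <;> field_simp

lemma IsStdDyadicInterval.half_add_one {a b : ℝ} (h : IsStdDyadicInterval a b) :
    IsStdDyadicInterval ((a + 1) / 2) ((b + 1) / 2) := by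
  obtain ⟨k, m, rfl, rfl, hb⟩ := h
  refine ⟨k + 2 ^ m, m + 1, ?_, ?_, by linarith⟩ <;> rw [pow_succ] <;> push_cast <;>
    field_simp
  ring

lemma IsStdDyadicInterval.of_half {a b : ℝ} (h : IsStdDyadicInterval (a / 2) (b / 2))
    (hb : b ≤ 1) : IsStdDyadicInterval a b := by
  obtain ⟨k, m, h₁, h₂, -⟩ := h
  have hk : (0 : ℝ) ≤ k := k.cast_nonneg
  cases m with
  | zero => simp at h₂; linarith
  | succ m =>
    refine ⟨k, m, ?_, ?_, hb⟩
    · rw [pow_succ] at h₁; field_simp at h₁ ⊢; linarith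
    · rw [pow_succ] at h₂; field_simp at h₂ ⊢; linarith

lemma IsStdDyadicInterval.of_half_add_one {a b : ℝ}
    (h : IsStdDyadicInterval ((a + 1) / 2) ((b + 1) / 2)) (ha : 0 ≤ a) :
    IsStdDyadicInterval a b := by
  obtain ⟨k, m, h₁, h₂, hb⟩ := h
  cases m with
  | zero => simp at h₁ h₂; linarith
  | succ m =>
    rw [pow_succ] at h₁ h₂
    field_simp at h₁ h₂
    have hp : (0 : ℝ) < 2 ^ m := by positivity
    have hle : 2 ^ m ≤ k := by
      have : (2 : ℝ) ^ m ≤ k := by nlinarith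
      exact_mod_cast this
    refine ⟨k - 2 ^ m, m, ?_, ?_, by linarith⟩ <;> push_cast [Nat.cast_sub hle] <;>
      field_simp <;> linarith

/-- The only standard dyadic interval with `1/2` in its interior is `[0,1]`. -/
lemma IsStdDyadicInterval.eq_zero_one {a b : ℝ} (h : IsStdDyadicInterval a b)
    (ha : a < 1 / 2) (hb : 1 / 2 < b) : a = 0 ∧ b = 1 := by
  obtain ⟨k, m, rfl, rfl, h1⟩ := h
  cases m with
  | zero =>
    have hk : (k : ℝ) < 1 := by simp at ha; linarith
    have : k = 0 := by
      have : k < 1 := by exact_mod_cast hk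
      omega
    simp [this]
  | succ m =>
    rw [pow_succ] at ha hb
    field_simp at ha hb
    have h₁ : k < 2 ^ m := by exact_mod_cast ha
    have h₂ : 2 ^ m < k + 1 := by exact_mod_cast hb
    omega

lemma isStdDyadicPartitionSet_zero_one : IsStdDyadicPartitionSet {0, 1} := by
  refine ⟨by simp, by simp, ?_, ?_⟩
  · intro x hx
    simp only [Finset.coe_insert, Finset.coe_singleton, Set.mem_insert_iff,
      Set.mem_singleton_iff] at hx
    rcases hx with rfl | rfl <;> simp
  · intro a ha b hb hab _
    simp only [Finset.mem_insert, Finset.mem_singleton] at ha hb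
    refine ⟨0, 0, ?_, ?_, ?_⟩ <;> rcases ha with rfl | rfl <;> rcases hb with rfl | rfl <;>
      norm_num at *

/-- The union of the rescaling of `S` into `[0,1/2]` and of `T` into `[1/2,1]`. -/
noncomputable def glueHalves (S T : Finset ℝ) : Finset ℝ :=
  S.image (fun x => x / 2) ∪ T.image (fun x => (x + 1) / 2)

lemma mem_glueHalves {S T : Finset ℝ} {z : ℝ} :
    z ∈ glueHalves S T ↔ (∃ x ∈ S, x / 2 = z) ∨ ∃ y ∈ T, (y + 1) / 2 = z := by
  simp [glueHalves]

lemma half_mem_glueHalves {S T : Finset ℝ} {x : ℝ} (hx : x ∈ S) :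
    x / 2 ∈ glueHalves S T :=
  mem_glueHalves.2 (.inl ⟨x, hx, rfl⟩)

lemma half_add_one_mem_glueHalves {S T : Finset ℝ} {y : ℝ} (hy : y ∈ T) :
    (y + 1) / 2 ∈ glueHalves S T :=
  mem_glueHalves.2 (.inr ⟨y, hy, rfl⟩)

lemma IsStdDyadicPartitionSet.glueHalves {S T : Finset ℝ} (hS : IsStdDyadicPartitionSet S)
    (hT : IsStdDyadicPartitionSet T) : IsStdDyadicPartitionSet (glueHalves S T) := by
  obtain ⟨hS0, hS1, hSI, hS⟩ := hS
  obtain ⟨hT0, hT1, hTI, hT⟩ := hT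
  have left : ∀ x ∈ S, ∀ y ∈ S, x / 2 < y / 2 →
      (∀ c ∈ _root_.glueHalves S T, ¬(x / 2 < c ∧ c < y / 2)) →
      IsStdDyadicInterval (x / 2) (y / 2) := fun x hx y hy hxy hc =>
    (hS x hx y hy (by linarith) fun c hcS hcxy =>
      hc _ (half_mem_glueHalves hcS) ⟨by linarith, by linarith⟩).half
  have right : ∀ x ∈ T, ∀ y ∈ T, (x + 1) / 2 < (y + 1) / 2 →
      (∀ c ∈ _root_.glueHalves S T, ¬((x + 1) / 2 < c ∧ c < (y + 1) / 2)) →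
      IsStdDyadicInterval ((x + 1) / 2) ((y + 1) / 2) := fun x hx y hy hxy hc =>
    (hT x hx y hy (by linarith) fun c hcT hcxy =>
      hc _ (half_add_one_mem_glueHalves hcT) ⟨by linarith, by linarith⟩).half_add_one
  refine ⟨by simpa using half_mem_glueHalves (T := T) hS0, ?_, ?_, ?_⟩
  · have := half_add_one_mem_glueHalves (S := S) hT1
    norm_num at this
    exact this
  · intro z hz
    rcases mem_glueHalves.1 hz with ⟨x, hx, rfl⟩ | ⟨x, hx, rfl⟩
    · have := hSI hx
      exact ⟨by linarith [this.1], by linarith [this.2]⟩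
    · have := hTI hx
      exact ⟨by linarith [this.1], by linarith [this.2]⟩
  · intro a ha b hb hab hc
    rcases mem_glueHalves.1 ha with ⟨x, hx, rfl⟩ | ⟨x, hx, rfl⟩ <;>
      rcases mem_glueHalves.1 hb with ⟨y, hy, rfl⟩ | ⟨y, hy, rfl⟩
    · exact left x hx y hy hab hc
    · have hx1 := (hSI hx).2
      have hy0 := (hTI hy).1
      rcases hx1.eq_or_lt with rfl | hx1
      · have h : (1 : ℝ) / 2 = (0 + 1) / 2 := by norm_num
        rw [h] at hab hc ⊢
        exact right 0 hT0 y hy hab hc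
      · rcases hy0.eq_or_lt with rfl | hy0
        · rw [zero_add] at hab hc ⊢
          exact left x hx 1 hS1 hab hc
        · exact absurd ⟨by linarith, by linarith⟩ (hc _ (half_mem_glueHalves hS1))
    · linarith [(hTI hx).1, (hSI hy).2]
    · exact right x hx y hy hab hc

lemma IsStdDyadicPartitionSet.mem_left_iff {S T : Finset ℝ} (hS : IsStdDyadicPartitionSet S)
    (hT : IsStdDyadicPartitionSet T) {x : ℝ} :
    x ∈ S ↔ x ≤ 1 ∧ x / 2 ∈ _root_.glueHalves S T := by
  refine ⟨fun hx => ⟨(hS.2.2.1 hx).2, half_mem_glueHalves hx⟩, fun ⟨hx, h⟩ => ?_⟩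
  rcases mem_glueHalves.1 h with ⟨y, hy, h⟩ | ⟨y, hy, h⟩
  · rwa [show x = y by linarith]
  · have := (hT.2.2.1 hy).1
    rw [show x = 1 by linarith]
    exact hS.2.1

lemma IsStdDyadicPartitionSet.mem_right_iff {S T : Finset ℝ} (hS : IsStdDyadicPartitionSet S)
    (hT : IsStdDyadicPartitionSet T) {x : ℝ} :
    x ∈ T ↔ 0 ≤ x ∧ (x + 1) / 2 ∈ _root_.glueHalves S T := by
  refine ⟨fun hx => ⟨(hT.2.2.1 hx).1, half_add_one_mem_glueHalves hx⟩, fun ⟨hx, h⟩ => ?_⟩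
  rcases mem_glueHalves.1 h with ⟨y, hy, h⟩ | ⟨y, hy, h⟩
  · have := (hS.2.2.1 hy).2
    rw [show x = 0 by linarith]
    exact hT.1
  · rwa [show x = y by linarith]

lemma glueHalves_ne_zero_one {S T : Finset ℝ} (hS : IsStdDyadicPartitionSet S) :
    glueHalves S T ≠ {0, 1} := by
  intro h
  have := half_mem_glueHalves (T := T) hS.2.1
  rw [h] at this
  norm_num at this

lemma IsStdDyadicPartitionSet.half_mem {S : Finset ℝ} (hS : IsStdDyadicPartitionSet S)
    (hne : S ≠ {0, 1}) : 1 / 2 ∈ S := by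
  obtain ⟨h0, h1, hI, hd⟩ := hS
  by_contra hmem
  obtain ⟨a, ha, hamax⟩ := (S.filter (· < 1 / 2)).exists_max_image id
    ⟨0, by simp [h0]⟩
  obtain ⟨b, hb, hbmin⟩ := (S.filter (1 / 2 < ·)).exists_min_image id
    ⟨1, by simp only [Finset.mem_filter]; exact ⟨h1, by norm_num⟩⟩
  simp only [Finset.mem_filter, id] at ha hb hamax hbmin
  have hcons : ∀ c ∈ S, c ≤ a ∨ b ≤ c := fun c hc => by
    rcases lt_trichotomy c (1 / 2) with h | h | h
    · exact .inl (hamax c ⟨hc, h⟩)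
    · exact absurd (h ▸ hc) hmem
    · exact .inr (hbmin c ⟨hc, h⟩)
  obtain ⟨rfl, rfl⟩ := (hd a ha.1 b hb.1 (ha.2.trans hb.2) fun c hc hab => by
    rcases hcons c hc with h | h <;> linarith [hab.1, hab.2]).eq_zero_one ha.2 hb.2
  apply hne
  ext x
  simp only [Finset.mem_insert, Finset.mem_singleton]
  refine ⟨fun hx => ?_, by rintro (rfl | rfl) <;> assumption⟩
  have := hI hx
  exact (hcons x hx).imp (fun h => le_antisymm h this.1) (fun h => le_antisymm this.2 h)

lemma IsStdDyadicPartitionSet.exists_glueHalves {S : Finset ℝ}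
    (hS : IsStdDyadicPartitionSet S) (hne : S ≠ {0, 1}) :
    ∃ L R : Finset ℝ, IsStdDyadicPartitionSet L ∧ IsStdDyadicPartitionSet R ∧
      L.card < S.card ∧ R.card < S.card ∧ S = _root_.glueHalves L R := by
  have hhalf := hS.half_mem hne
  obtain ⟨h0, h1, hI, hd⟩ := hS
  set L := (S.filter (· ≤ 1 / 2)).image (fun x => 2 * x) with hL
  set R := (S.filter (1 / 2 ≤ ·)).image (fun x => 2 * x - 1) with hR
  have memL : ∀ x, x ∈ L ↔ x / 2 ∈ S ∧ x ≤ 1 := fun x => by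
    simp only [hL, Finset.mem_image, Finset.mem_filter]
    constructor
    · rintro ⟨y, ⟨hy, hy'⟩, rfl⟩
      exact ⟨by rwa [mul_div_cancel_left₀ y two_ne_zero], by linarith⟩
    · rintro ⟨h, h'⟩
      exact ⟨x / 2, ⟨h, by linarith⟩, by ring⟩
  have memR : ∀ x, x ∈ R ↔ (x + 1) / 2 ∈ S ∧ 0 ≤ x := fun x => by
    simp only [hR, Finset.mem_image, Finset.mem_filter]
    constructor
    · rintro ⟨y, ⟨hy, hy'⟩, rfl⟩
      exact ⟨by rwa [show (2 * y - 1 + 1) / 2 = y by ring], by linarith⟩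
    · rintro ⟨h, h'⟩
      exact ⟨(x + 1) / 2, ⟨h, by linarith⟩, by ring⟩
  refine ⟨L, R, ⟨?_, ?_, ?_, ?_⟩, ⟨?_, ?_, ?_, ?_⟩, ?_, ?_, ?_⟩
  · simp [memL, h0]
  · exact (memL 1).2 ⟨hhalf, le_rfl⟩
  · intro x hx
    have hx := (memL x).1 hx
    exact ⟨by linarith [(hI hx.1).1], hx.2⟩
  · intro a ha b hb hab hc
    rw [memL] at ha hb
    refine (hd _ ha.1 _ hb.1 (by linarith) fun c hcS hcab => ?_).of_half hb.2
    refine hc (2 * c) ((memL _).2 ⟨?_, by linarith⟩) ⟨by linarith, by linarith⟩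
    rwa [mul_div_cancel_left₀ c two_ne_zero]
  · rw [memR, zero_add]
    exact ⟨hhalf, le_rfl⟩
  · rw [memR, show ((1 : ℝ) + 1) / 2 = 1 by norm_num]
    exact ⟨h1, zero_le_one⟩
  · intro x hx
    have hx := (memR x).1 hx
    exact ⟨hx.2, by linarith [(hI hx.1).2]⟩
  · intro a ha b hb hab hc
    rw [memR] at ha hb
    refine (hd _ ha.1 _ hb.1 (by linarith) fun c hcS hcab => ?_).of_half_add_one ha.2
    refine hc (2 * c - 1) ((memR _).2 ⟨?_, by linarith⟩) ⟨by linarith, by linarith⟩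
    rwa [show (2 * c - 1 + 1) / 2 = c by ring]
  · refine Finset.card_image_le.trans_lt (Finset.card_lt_card ?_)
    exact Finset.filter_ssubset.2 ⟨1, h1, by norm_num⟩
  · refine Finset.card_image_le.trans_lt (Finset.card_lt_card ?_)
    exact Finset.filter_ssubset.2 ⟨0, h0, by norm_num⟩
  · ext z
    rw [mem_glueHalves]
    constructor
    · intro hz
      rcases le_total z (1 / 2) with h | h
      · exact .inl ⟨2 * z, Finset.mem_image_of_mem _ (Finset.mem_filter.2 ⟨hz, h⟩), by ring⟩
      · exact .inr ⟨2 * z - 1, Finset.mem_image.2 ⟨z, Finset.mem_filter.2 ⟨hz, h⟩, rfl⟩, by ring⟩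
    · rintro (⟨x, hx, rfl⟩ | ⟨x, hx, rfl⟩)
      · exact ((memL x).1 hx).1
      · exact ((memR x).1 hx).1

lemma BinTree.toPartition_node (l r : BinTree) :
    (BinTree.node l r).toPartition = glueHalves l.toPartition r.toPartition := rfl

lemma BinTree.isStdDyadicPartitionSet_toPartition (t : BinTree) :
    IsStdDyadicPartitionSet t.toPartition := by
  induction t with
  | leaf => exact isStdDyadicPartitionSet_zero_one
  | node l r hl hr => exact hl.glueHalves hr

lemma BinTree.toPartition_injective : Function.Injective BinTree.toPartition := by
  intro s
  induction s with
  | leaf =>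
    rintro (_ | ⟨l, r⟩) h
    · rfl
    · exact absurd h.symm (glueHalves_ne_zero_one l.isStdDyadicPartitionSet_toPartition)
  | node l r hl hr =>
    rintro (_ | ⟨l', r'⟩) h
    · exact absurd h (glueHalves_ne_zero_one l.isStdDyadicPartitionSet_toPartition)
    · rw [toPartition_node, toPartition_node] at h
      have pl := l.isStdDyadicPartitionSet_toPartition
      have pr := r.isStdDyadicPartitionSet_toPartition
      have pl' := l'.isStdDyadicPartitionSet_toPartition
      have pr' := r'.isStdDyadicPartitionSet_toPartition
      have hleft : l.toPartition = l'.toPartition := Finset.ext fun x => by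
        rw [pl.mem_left_iff pr, h, ← pl'.mem_left_iff pr']
      have hright : r.toPartition = r'.toPartition := Finset.ext fun x => by
        rw [pl.mem_right_iff pr, h, ← pl'.mem_right_iff pr']
      rw [hl hleft, hr hright]

lemma IsStdDyadicPartitionSet.exists_toPartition_eq {S : Finset ℝ}
    (hS : IsStdDyadicPartitionSet S) : ∃ t : BinTree, t.toPartition = S := by
  by_cases hne : S = {0, 1}
  · exact ⟨.leaf, hne.symm⟩
  · obtain ⟨L, R, hL, hR, hcL, hcR, h⟩ := hS.exists_glueHalves hne
    obtain ⟨l, hl⟩ := hL.exists_toPartition_eq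
    obtain ⟨r, hr⟩ := hR.exists_toPartition_eq
    exact ⟨.node l r, by rw [BinTree.toPartition_node, hl, hr, h]⟩
termination_by S.card

/-- `Φ` is a bijection from the set of finite rooted binary trees onto the set of
standard dyadic partitions of `[0,1]`. -/
theorem binTree_toPartition_bijOn :
    Set.BijOn BinTree.toPartition Set.univ {S : Finset ℝ | IsStdDyadicPartitionSet S} :=
  ⟨fun t _ => t.isStdDyadicPartitionSet_toPartition, BinTree.toPartition_injective.injOn,
    fun _ hS => hS.exists_toPartition_eq.imp fun _ ht => ⟨trivial, ht⟩⟩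
end

section
/- The function φ on Thompson's group F defined by φ(g) = ∫₀¹ √(g'(x)) dx (the derivative g' being defined outside the finite set of breakpoints of g) is a positive definite function on F with φ(identity) = 1. -/
/-- The group of homeomorphisms of a space, under composition. -/
instance homeoGroup {X : Type*} [TopologicalSpace X] : Group (X ≃ₜ X) where
  mul g h := h.trans g
  one := Homeomorph.refl X
  inv := Homeomorph.symm
  mul_assoc a b c := Homeomorph.ext fun _ => rfl
  one_mul a := Homeomorph.ext fun _ => rfl
  mul_one a := Homeomorph.ext fun _ => rfl
  inv_mul_cancel a := Homeomorph.ext a.symm_apply_apply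

/-- `φ : G → ℂ` is positive definite: for all `n`, `g : Fin n → G`, `c : Fin n → ℂ`, the
sum `Σ_{i,j} cᵢ conj(cⱼ) φ(gⱼ⁻¹ gᵢ)` is a nonnegative real number. -/
def IsPosDefFn {G : Type*} [Group G] (φ : G → ℂ) : Prop :=
  ∀ (n : ℕ) (g : Fin n → G) (c : Fin n → ℂ),
    0 ≤ (∑ i, ∑ j, c i * (starRingEnd ℂ) (c j) * φ ((g j)⁻¹ * g i)).re ∧
    (∑ i, ∑ j, c i * (starRingEnd ℂ) (c j) * φ ((g j)⁻¹ * g i)).im = 0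

open MeasureTheory

lemma extIcc_mem (g : Set.Icc (0:ℝ) 1 → Set.Icc (0:ℝ) 1) {x : ℝ} (hx : x ∈ Set.Icc (0:ℝ) 1) :
    extIcc g x ∈ Set.Icc (0:ℝ) 1 := by
  simp only [extIcc, hx, dif_pos]
  exact (g _).2

lemma extIcc_mul (a b : Set.Icc (0:ℝ) 1 ≃ₜ Set.Icc (0:ℝ) 1) (x : ℝ) :
    extIcc ⇑(a * b) x = extIcc a (extIcc b x) := by
  by_cases hx : x ∈ Set.Icc (0:ℝ) 1
  · have h2 : ((b ⟨x, hx⟩ : Set.Icc (0:ℝ) 1) : ℝ) ∈ Set.Icc (0:ℝ) 1 := (b _).2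
    simp only [extIcc, hx, h2, dif_pos]
    rfl
  · simp only [extIcc, hx, dif_neg, not_false_eq_true]

lemma extIcc_one :
    extIcc ⇑(1 : Set.Icc (0:ℝ) 1 ≃ₜ Set.Icc (0:ℝ) 1) = id := by
  funext x
  by_cases hx : x ∈ Set.Icc (0:ℝ) 1
  · simp only [extIcc, hx, dif_pos]
    rfl
  · simp only [extIcc, hx, dif_neg, not_false_eq_true, id]

lemma extIcc_inv_apply (a : Set.Icc (0:ℝ) 1 ≃ₜ Set.Icc (0:ℝ) 1) (x : ℝ) :
    extIcc ⇑a⁻¹ (extIcc a x) = x := by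
  rw [← extIcc_mul, inv_mul_cancel, extIcc_one, id]

lemma extIcc_injective (a : Set.Icc (0:ℝ) 1 ≃ₜ Set.Icc (0:ℝ) 1) :
    Function.Injective (extIcc a) :=
  Function.LeftInverse.injective (extIcc_inv_apply a)

lemma extIcc_image_Icc (a : Set.Icc (0:ℝ) 1 ≃ₜ Set.Icc (0:ℝ) 1) :
    extIcc a '' Set.Icc 0 1 = Set.Icc 0 1 := by
  apply Set.Subset.antisymm
  · rintro _ ⟨x, hx, rfl⟩
    exact extIcc_mem _ hx
  · intro y hy
    refine ⟨extIcc ⇑a⁻¹ y, extIcc_mem _ hy, ?_⟩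
    simpa using extIcc_inv_apply a⁻¹ y

/-- Every point of `[x 0, x n]` off a subdivision lies in the interior of one of its pieces. -/
lemma exists_mem_Ioo_of_subdivision {n : ℕ} (x : Fin (n + 1) → ℝ) {t : ℝ}
    (h0 : x 0 ≤ t) (h1 : t ≤ x (Fin.last n)) (ht : t ∉ Set.range x) :
    ∃ i : Fin n, t ∈ Set.Ioo (x i.castSucc) (x i.succ) := by
  by_contra! hne
  have key : ∀ i : Fin (n + 1), x i < t := by
    intro i
    induction i using Fin.induction with
    | zero => exact lt_of_le_of_ne h0 fun h => ht ⟨_, h⟩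
    | succ i ih =>
      refine lt_of_le_of_ne ?_ fun h => ht ⟨_, h⟩
      by_contra! hlt
      exact hne i ⟨ih, hlt⟩
  exact (key (Fin.last n)).not_ge h1

/-- Off a finite set, a piecewise linear map of Thompson type has a positive derivative, and these
derivatives are uniformly bounded. -/
lemma IsPLThompson.exists_hasDerivAt {f : ℝ → ℝ} (hf : IsPLThompson f) :
    ∃ (B : Set ℝ) (M : ℝ), B.Finite ∧
      ∀ t ∈ Set.Icc (0:ℝ) 1 \ B, ∃ d, 0 < d ∧ d ≤ M ∧ HasDerivAt f d t := by
  obtain ⟨n, x, h0, h1, -, -, hp⟩ := hf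
  choose k c hkc using hp
  refine ⟨Set.range x, ∑ i, (2:ℝ) ^ k i, Set.finite_range x, ?_⟩
  rintro t ⟨⟨ht0, ht1⟩, htB⟩
  obtain ⟨i, hi⟩ := exists_mem_Ioo_of_subdivision x (h0 ▸ ht0) (h1 ▸ ht1) htB
  refine ⟨2 ^ k i, by positivity,
    Finset.single_le_sum (f := fun i => (2:ℝ) ^ k i) (fun j _ => by positivity)
      (Finset.mem_univ i), ?_⟩
  have hlin : HasDerivAt (fun t : ℝ => (2:ℝ) ^ k i * t + c i) (2 ^ k i) t := by
    simpa using ((hasDerivAt_id t).const_mul ((2:ℝ) ^ k i)).add_const (c i)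
  refine hlin.congr_of_eventuallyEq ?_
  filter_upwards [Ioo_mem_nhds hi.1 hi.2] with s hs
  exact hkc i s (Set.Ioo_subset_Icc_self hs)

/-- Change of variables `x = b⁻¹ y` in `∫ √((a⁻¹ b)'(x)) dx`. -/
lemma integral_sqrt_deriv_inv_mul (a b : Set.Icc (0:ℝ) 1 ≃ₜ Set.Icc (0:ℝ) 1)
    (hb : IsPLThompson (extIcc ⇑b⁻¹)) (hab : IsPLThompson (extIcc ⇑(a⁻¹ * b))) :
    ∫ x in (0:ℝ)..1, √(deriv (extIcc ⇑(a⁻¹ * b)) x) =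
      ∫ y in Set.Icc (0:ℝ) 1, √(deriv (extIcc ⇑b⁻¹) y) * √(deriv (extIcc ⇑a⁻¹) y) := by
  have hinj := extIcc_injective b⁻¹
  set f := extIcc ⇑b⁻¹ with hf
  obtain ⟨B, _, hB, hdb⟩ := hb.exists_hasDerivAt
  obtain ⟨C, _, hC, hdab⟩ := hab.exists_hasDerivAt
  set T := B ∪ f ⁻¹' C
  have hTfin : T.Finite := hB.union (hC.preimage hinj.injOn)
  have hae {U : Set ℝ} (hU : U.Finite) :
      (Set.Icc (0:ℝ) 1 \ U : Set ℝ) =ᵐ[volume] Set.Icc (0:ℝ) 1 :=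
    sdiff_null_ae_eq_self (hU.measure_zero volume)
  have himg : f '' (Set.Icc 0 1 \ T) = Set.Icc 0 1 \ f '' T := by
    rw [Set.image_sdiff hinj, hf, extIcc_image_Icc]
  have hderiv : ∀ y ∈ Set.Icc (0:ℝ) 1 \ T,
      HasDerivWithinAt f (deriv f y) (Set.Icc 0 1 \ T) y := by
    rintro y ⟨hy, hyT⟩
    obtain ⟨d, -, -, hd⟩ := hdb y ⟨hy, fun h => hyT (.inl h)⟩
    exact hd.differentiableAt.hasDerivAt.hasDerivWithinAt
  have hmeas : MeasurableSet (Set.Icc (0:ℝ) 1 \ T) := measurableSet_Icc.diff hTfin.measurableSet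
  rw [intervalIntegral.integral_of_le zero_le_one, ← integral_Icc_eq_integral_Ioc,
    ← setIntegral_congr_set (hae (hTfin.image f)), ← himg,
    integral_image_eq_integral_abs_deriv_smul hmeas hderiv hinj.injOn,
    ← setIntegral_congr_set (hae hTfin)]
  refine setIntegral_congr_fun hmeas ?_
  rintro y ⟨hy, hyT⟩
  obtain ⟨d, hd0, -, hd⟩ := hdb y ⟨hy, fun h => hyT (.inl h)⟩
  obtain ⟨e, he0, -, he⟩ := hdab (f y) ⟨extIcc_mem _ hy, fun h => hyT (.inr h)⟩
  have hcomp : HasDerivAt (extIcc ⇑a⁻¹) (e * d) y := by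
    have hfun : extIcc ⇑(a⁻¹ * b) ∘ f = extIcc ⇑a⁻¹ := by
      funext z
      rw [Function.comp_apply, hf, ← extIcc_mul, mul_inv_cancel_right]
    exact hfun ▸ he.comp y hd
  simp only [hd.deriv, he.deriv, hcomp.deriv, smul_eq_mul, abs_of_pos hd0]
  rw [Real.sqrt_mul he0.le, mul_left_comm, Real.mul_self_sqrt hd0.le, mul_comm]

lemma IsPLThompson.memLp_sqrt_deriv {f : ℝ → ℝ} (hf : IsPLThompson f) :
    MemLp (fun y => √(deriv f y)) 2 (volume.restrict (Set.Icc (0:ℝ) 1)) := by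
  obtain ⟨B, M, hB, hd⟩ := hf.exists_hasDerivAt
  refine MemLp.of_bound (measurable_deriv f).sqrt.aestronglyMeasurable (√M) ?_
  rw [ae_restrict_iff' measurableSet_Icc]
  have hBae : ∀ᵐ y, y ∉ B := measure_eq_zero_iff_ae_notMem.mp (hB.measure_zero volume)
  filter_upwards [hBae] with y hyB hy
  obtain ⟨d, -, hdM, hd⟩ := hd y ⟨hy, hyB⟩
  rw [Real.norm_of_nonneg (Real.sqrt_nonneg _), hd.deriv]
  exact Real.sqrt_le_sqrt hdM

/-- The quadratic form of a real Gram matrix in `L²` is the integral of a squared modulus. -/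
lemma sum_mul_conj_mul_integral {α : Type*} [MeasurableSpace α] {μ : Measure α} {ι : Type*}
    [Fintype ι] (p : ι → α → ℝ) (hp : ∀ i, MemLp (p i) 2 μ) (c : ι → ℂ) :
    ∑ i, ∑ j, c i * (starRingEnd ℂ) (c j) * ((∫ y, p i y * p j y ∂μ : ℝ) : ℂ) =
      ((∫ y, Complex.normSq (∑ i, c i * p i y) ∂μ : ℝ) : ℂ) := by
  have hint (i j : ι) : Integrable
      (fun y => c i * (starRingEnd ℂ) (c j) * ((p i y * p j y : ℝ) : ℂ)) μ :=
    ((hp i).integrable_mul (hp j)).ofReal.const_mul _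
  simp_rw [← integral_complex_ofReal, ← integral_const_mul]
  simp_rw [← integral_finsetSum _ fun j _ => hint _ j]
  rw [← integral_finsetSum _ fun i _ => integrable_finsetSum _ fun j _ => hint i j]
  refine integral_congr_ae (.of_forall fun y => ?_)
  simp only [← Complex.mul_conj, map_sum, map_mul, Complex.conj_ofReal, Finset.sum_mul_sum,
    Complex.ofReal_mul]
  exact Finset.sum_congr rfl fun i _ => Finset.sum_congr rfl fun j _ => by ring

/-- The function `g ↦ ∫₀¹ √(g'(x)) dx` on Thompson's group `F` (realized as the subgroup
`H` of the group of homeomorphisms of `[0,1]`) is positive definite and equals `1` at the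
identity. -/
theorem sqrt_deriv_integral_posdef
    (H : Subgroup (Set.Icc (0:ℝ) 1 ≃ₜ Set.Icc (0:ℝ) 1))
    (hH : ∀ g, g ∈ H ↔ IsPLThompson (extIcc ⇑g)) :
    IsPosDefFn (fun g : H =>
      ((∫ x in (0:ℝ)..1,
          Real.sqrt (deriv (extIcc ⇑(g : Set.Icc (0:ℝ) 1 ≃ₜ Set.Icc (0:ℝ) 1)) x) : ℝ) : ℂ)) ∧
    ((∫ x in (0:ℝ)..1,
        Real.sqrt (deriv (extIcc ⇑((1 : H) : Set.Icc (0:ℝ) 1 ≃ₜ Set.Icc (0:ℝ) 1)) x) : ℝ)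
      = 1) := by
  refine ⟨fun n g c => ?_, ?_⟩
  · have hPL (u : H) : IsPLThompson (extIcc ⇑(u : Set.Icc (0:ℝ) 1 ≃ₜ Set.Icc (0:ℝ) 1)) :=
      (hH _).mp u.2
    have hsum := sum_mul_conj_mul_integral _ (fun i => (hPL (g i)⁻¹).memLp_sqrt_deriv) c
    have hφ (i j : Fin n) := integral_sqrt_deriv_inv_mul _ _
      (hPL (g i)⁻¹) (hPL ((g j)⁻¹ * g i))
    simp only [Subgroup.coe_mul, Subgroup.coe_inv] at hsum hφ ⊢
    simp only [hφ, hsum, Complex.ofReal_re, Complex.ofReal_im, and_true]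
    exact integral_nonneg fun y => Complex.normSq_nonneg _
  · simp [extIcc_one]
end

section
/- The function φ on Thompson's group F defined by φ(g) = Lebesgue measure of the set {x ∈ [0,1] : g(x) = x} is a positive definite function on F with φ(identity) = 1. -/
open MeasureTheory

open scoped ComplexOrder in
/-- The kernel `1_{a i = a j}` is positive semidefinite: its quadratic form is a sum of squares
over the fibres of `a`. -/
theorem sum_mul_conj_mul_ite_eq_nonneg {ι Y : Type*} [Fintype ι] [DecidableEq Y]
    (a : ι → Y) (c : ι → ℂ) :
    0 ≤ ∑ i, ∑ j, c i * (starRingEnd ℂ) (c j) * (if a i = a j then 1 else 0) := by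
  have key : ∑ i, ∑ j, c i * (starRingEnd ℂ) (c j) * (if a i = a j then 1 else 0) =
      ∑ y ∈ Finset.univ.image a, (∑ i, if a i = y then c i else (0 : ℂ)) *
        (starRingEnd ℂ) (∑ j, if a j = y then c j else (0 : ℂ)) := by
    simp_rw [map_sum, Finset.sum_mul_sum]
    rw [Finset.sum_comm (s := Finset.univ.image a)]
    refine Finset.sum_congr rfl fun i _ => ?_
    rw [Finset.sum_comm (s := Finset.univ.image a)]
    refine Finset.sum_congr rfl fun j _ => ?_
    rw [Finset.sum_eq_single_of_mem (a i) (Finset.mem_image_of_mem a (Finset.mem_univ i))]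
    · by_cases h : a i = a j
      · simp [h]
      · simp [h, Ne.symm h]
    · intro y _ hy
      simp [hy.symm]
  rw [key]
  exact Finset.sum_nonneg fun y _ => mul_star_self_nonneg _

open scoped ComplexOrder in
/-- The measures of the coincidence sets of a finite family of functions form a positive
semidefinite kernel. -/
theorem sum_mul_conj_mul_measureReal_eq_nonneg {ι Ω Y : Type*} [Fintype ι] [MeasurableSpace Ω]
    (μ : Measure Ω) [IsFiniteMeasure μ] (f : ι → Ω → Y)
    (hf : ∀ i j, MeasurableSet {ω | f i ω = f j ω}) (c : ι → ℂ) :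
    0 ≤ ∑ i, ∑ j, c i * (starRingEnd ℂ) (c j) * (μ.real {ω | f i ω = f j ω} : ℂ) := by
  classical
  have hind : ∀ i j, (fun ω => if f i ω = f j ω then (1 : ℂ) else 0) =
      {ω | f i ω = f j ω}.indicator fun _ => (1 : ℂ) := fun i j => by
    ext ω
    simp [Set.indicator_apply]
  have hint : ∀ i j, Integrable
      (fun ω => c i * (starRingEnd ℂ) (c j) * (if f i ω = f j ω then (1 : ℂ) else 0)) μ :=
    fun i j => by
      refine Integrable.const_mul ?_ _
      rw [hind]
      exact (integrable_const _).indicator (hf i j)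
  have key : ∑ i, ∑ j, c i * (starRingEnd ℂ) (c j) * (μ.real {ω | f i ω = f j ω} : ℂ) =
      ∫ ω, ∑ i, ∑ j, c i * (starRingEnd ℂ) (c j) * (if f i ω = f j ω then (1 : ℂ) else 0) ∂μ := by
    rw [integral_finsetSum _ fun i _ => integrable_finsetSum _ fun j _ => hint i j]
    refine Finset.sum_congr rfl fun i _ => ?_
    rw [integral_finsetSum _ fun j _ => hint i j]
    refine Finset.sum_congr rfl fun j _ => ?_
    rw [integral_const_mul, hind, integral_indicator_const _ (hf i j)]
    simp
  rw [key]
  exact integral_nonneg fun ω => sum_mul_conj_mul_ite_eq_nonneg (fun i => f i ω) c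

/-- The fixed points of `extIcc g` in `[0,1]` have the same measure as those of `g`. -/
theorem volume_fixed_extIcc {g : Set.Icc (0:ℝ) 1 → Set.Icc (0:ℝ) 1} :
    volume {x ∈ Set.Icc (0:ℝ) 1 | extIcc g x = x} =
      volume {x : Set.Icc (0:ℝ) 1 | g x = x} := by
  rw [Measure.Subtype.volume_def, comap_subtype_coe_apply measurableSet_Icc]
  congr 1
  ext x
  constructor
  · rintro ⟨hx, h⟩
    rw [extIcc, dif_pos hx] at h
    exact ⟨⟨x, hx⟩, Subtype.ext h, rfl⟩
  · rintro ⟨y, hy, rfl⟩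
    refine ⟨y.2, ?_⟩
    rw [extIcc, dif_pos y.2]
    exact congrArg Subtype.val hy

/-- The function `g ↦ Leb{x ∈ [0,1] : g x = x}` on Thompson's group `F` (realized as the
subgroup `H` of the group of homeomorphisms of `[0,1]`) is positive definite and equals
`1` at the identity. -/
theorem fixed_point_measure_posdef
    (H : Subgroup (Set.Icc (0:ℝ) 1 ≃ₜ Set.Icc (0:ℝ) 1))
    (hH : ∀ g, g ∈ H ↔ IsPLThompson (extIcc ⇑g)) :
    IsPosDefFn (fun g : H =>
      ((volume {x ∈ Set.Icc (0:ℝ) 1 |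
          extIcc ⇑(g : Set.Icc (0:ℝ) 1 ≃ₜ Set.Icc (0:ℝ) 1) x = x}).toReal : ℂ)) ∧
    ((volume {x ∈ Set.Icc (0:ℝ) 1 |
        extIcc ⇑((1 : H) : Set.Icc (0:ℝ) 1 ≃ₜ Set.Icc (0:ℝ) 1) x = x}).toReal : ℂ) = 1 := by
  constructor
  · intro n g c
    have hφ : ∀ i j : Fin n, (volume {x ∈ Set.Icc (0:ℝ) 1 |
        extIcc ⇑(((g j)⁻¹ * g i : H) : Set.Icc (0:ℝ) 1 ≃ₜ Set.Icc (0:ℝ) 1) x = x}).toReal =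
        (volume : Measure (Set.Icc (0:ℝ) 1)).real {x | (g i).1 x = (g j).1 x} := fun i j => by
      rw [volume_fixed_extIcc, Measure.real]
      congr 2
      ext x
      exact (g j).1.toEquiv.symm_apply_eq
    have h := sum_mul_conj_mul_measureReal_eq_nonneg (volume : Measure (Set.Icc (0:ℝ) 1))
      (fun i => ⇑(g i).1)
      (fun i j => (isClosed_eq (g i).1.continuous (g j).1.continuous).measurableSet) c
    simp only [hφ]
    exact ⟨(Complex.le_def.1 h).1, (Complex.le_def.1 h).2.symm⟩
  · have h : {x : Set.Icc (0:ℝ) 1 |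
        ((1 : H) : Set.Icc (0:ℝ) 1 ≃ₜ Set.Icc (0:ℝ) 1) x = x} = Set.univ :=
      Set.eq_univ_of_forall fun _ => rfl
    rw [volume_fixed_extIcc, h]
    simp
end

section
/- Thompson's group F does not have Kazhdan's property (T): for every finite subset S ⊆ F and every ε > 0, there exist a complex Hilbert space H, a group homomorphism π from F to the group of unitary operators on H, and a unit vector ξ ∈ H such that ‖π(s)ξ − ξ‖ < ε for all s ∈ S, while the only vector of H fixed by π(g) for all g ∈ F is the zero vector. -/
open Filter Topology

/-- `g` fixes `0` and is multiplication by `2 ^ k` near `0`. -/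
def HasLogSlopeAtZero (g : Set.Icc (0:ℝ) 1 ≃ₜ Set.Icc (0:ℝ) 1) (k : ℤ) : Prop :=
  ∃ δ : ℝ, 0 < δ ∧ ∀ t : Set.Icc (0:ℝ) 1, (t : ℝ) ≤ δ → (g t : ℝ) = (2:ℝ) ^ k * t

theorem extIcc_apply_coe (g : Set.Icc (0:ℝ) 1 → Set.Icc (0:ℝ) 1) (t : Set.Icc (0:ℝ) 1) :
    extIcc g t = g t := by
  simp [extIcc]

theorem HasLogSlopeAtZero.unique {g : Set.Icc (0:ℝ) 1 ≃ₜ Set.Icc (0:ℝ) 1} {k l : ℤ}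
    (hk : HasLogSlopeAtZero g k) (hl : HasLogSlopeAtZero g l) : k = l := by
  obtain ⟨δ, hδ, h⟩ := hk
  obtain ⟨η, hη, h'⟩ := hl
  have hpos : 0 < min (min δ η) 1 := by positivity
  let t : Set.Icc (0:ℝ) 1 := ⟨min (min δ η) 1, hpos.le, min_le_right _ _⟩
  have h1 := h t ((min_le_left _ _).trans (min_le_left _ _))
  have h2 := h' t ((min_le_left _ _).trans (min_le_right _ _))
  have h3 : (2:ℝ) ^ k = 2 ^ l := mul_right_cancel₀ hpos.ne' (h1.symm.trans h2)
  exact zpow_right_injective₀ (by norm_num) (by norm_num) h3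

theorem HasLogSlopeAtZero.mul {g h : Set.Icc (0:ℝ) 1 ≃ₜ Set.Icc (0:ℝ) 1} {k l : ℤ}
    (hg : HasLogSlopeAtZero g k) (hh : HasLogSlopeAtZero h l) :
    HasLogSlopeAtZero (g * h) (k + l) := by
  obtain ⟨δ, hδ, hg⟩ := hg
  obtain ⟨η, hη, hh⟩ := hh
  have h2 : (0:ℝ) < 2 ^ l := by positivity
  refine ⟨min η (δ / 2 ^ l), by positivity, fun t ht => ?_⟩
  have e := hh t (ht.trans (min_le_left _ _))
  have ht' : (h t : ℝ) ≤ δ := by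
    rw [e, mul_comm]
    exact (le_div_iff₀ h2).1 (ht.trans (min_le_right _ _))
  change ((g (h t) : Set.Icc (0:ℝ) 1) : ℝ) = _
  rw [hg _ ht', e, zpow_add₀ two_ne_zero, mul_assoc]

theorem HasLogSlopeAtZero.exists_of_isPLThompson {g : Set.Icc (0:ℝ) 1 ≃ₜ Set.Icc (0:ℝ) 1}
    (hg : IsPLThompson (extIcc g)) : ∃ k, HasLogSlopeAtZero g k := by
  obtain ⟨n, x, h0, h1, hx, -, hp⟩ := hg
  obtain _ | n := n
  · exact absurd (h0.symm.trans h1) zero_ne_one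
  obtain ⟨k, c, h⟩ := hp 0
  rw [Fin.castSucc_zero, h0] at h
  have hδ : 0 < x (Fin.succ 0) := h0 ▸ hx (Fin.succ_pos 0)
  have hδ1 : x (Fin.succ 0) ≤ 1 := h1 ▸ hx.monotone (Fin.le_last _)
  have hgt : ∀ t : Set.Icc (0:ℝ) 1, (t : ℝ) ≤ x (Fin.succ 0) → (g t : ℝ) = 2 ^ k * t + c :=
    fun t ht => (extIcc_apply_coe g t).symm.trans (h t ⟨t.2.1, ht⟩)
  let d : Set.Icc (0:ℝ) 1 := ⟨x (Fin.succ 0), hδ.le, hδ1⟩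
  have hbot : (g ⊥ : ℝ) = 2 ^ k * 0 + c := hgt ⊥ hδ.le
  have hd : (g d : ℝ) = 2 ^ k * x (Fin.succ 0) + c := hgt d le_rfl
  have hlt : g ⊥ < g d := by
    rw [← Subtype.coe_lt_coe, hbot, hd]
    have : (0:ℝ) < 2 ^ k * x (Fin.succ 0) := by positivity
    linarith
  have hmono : StrictMono g := by
    rcases le_total (g ⊥) (g ⊤) with hle | hle
    · exact g.continuous.strictMono_of_inj_boundedOrder hle g.injective
    · have ha := g.continuous.strictAnti_of_inj_boundedOrder hle g.injective
      exact absurd (ha.antitone (bot_le : ⊥ ≤ d)) hlt.not_ge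
  have hg0 : g ⊥ = ⊥ := by
    obtain ⟨t, ht⟩ := g.surjective ⊥
    exact le_bot_iff.1 ((hmono.monotone (bot_le : ⊥ ≤ t)).trans ht.le)
  have hc : c = 0 := by
    have : (g ⊥ : ℝ) = 0 := by rw [hg0]; rfl
    linarith
  exact ⟨k, _, hδ, fun t ht => by rw [hgt t ht, hc, add_zero]⟩

/-- The standard generator of Thompson's group with slopes `1/2`, `1`, `2`. -/
noncomputable def thompsonX0 : Set.Icc (0:ℝ) 1 ≃ₜ Set.Icc (0:ℝ) 1 where
  toFun t := ⟨max (t / 2) (max (t - 1 / 4) (2 * t - 1)), by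
    obtain ⟨t, h0, h1⟩ := t
    exact ⟨le_max_of_le_left (by simp only; linarith),
      max_le (by simp only; linarith) (max_le (by simp only; linarith) (by simp only; linarith))⟩⟩
  invFun t := ⟨min (2 * t) (min (t + 1 / 4) ((t + 1) / 2)), by
    obtain ⟨t, h0, h1⟩ := t
    exact ⟨le_min (by simp only; linarith) (le_min (by simp only; linarith)
      (by simp only; linarith)),
      (min_le_right _ _).trans ((min_le_right _ _).trans (by simp only; linarith))⟩⟩
  left_inv := by
    rintro ⟨t, h0, h1⟩
    ext
    grind
  right_inv := by
    rintro ⟨t, h0, h1⟩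
    ext
    grind
  continuous_toFun := by fun_prop
  continuous_invFun := by fun_prop

theorem thompsonX0_apply (t : Set.Icc (0:ℝ) 1) :
    (thompsonX0 t : ℝ) = max ((t:ℝ) / 2) (max (t - 1 / 4) (2 * t - 1)) := rfl

theorem isPLThompson_thompsonX0 : IsPLThompson (extIcc thompsonX0) := by
  refine ⟨3, ![0, 1 / 2, 3 / 4, 1], rfl, rfl, ?_, ?_, ?_⟩
  · rw [Fin.strictMono_iff_lt_succ]
    intro i
    fin_cases i
    · change (0:ℝ) < 1 / 2
      norm_num
    · change (1 / 2 : ℝ) < 3 / 4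
      norm_num
    · change (3 / 4 : ℝ) < 1
      norm_num
  · intro i
    fin_cases i
    · exact ⟨0, 0, by simp⟩
    · exact ⟨1, 1, by simp⟩
    · exact ⟨3, 2, by norm_num⟩
    · exact ⟨1, 0, by simp⟩
  · have key : ∀ t : ℝ, 0 ≤ t → t ≤ 1 →
        extIcc thompsonX0 t = max (t / 2) (max (t - 1 / 4) (2 * t - 1)) := fun t h0 h1 =>
      (extIcc_apply_coe thompsonX0 ⟨t, h0, h1⟩).trans (thompsonX0_apply _)
    intro i
    fin_cases i
    · refine ⟨-1, 0, fun t (ht : t ∈ Set.Icc (0:ℝ) (1 / 2)) => ?_⟩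
      obtain ⟨h0, h1⟩ := ht
      rw [key t (by linarith) (by linarith), zpow_neg_one]
      grind
    · refine ⟨0, -1 / 4, fun t (ht : t ∈ Set.Icc (1 / 2 : ℝ) (3 / 4)) => ?_⟩
      obtain ⟨h0, h1⟩ := ht
      rw [key t (by linarith) (by linarith), zpow_zero]
      grind
    · refine ⟨1, -1, fun t (ht : t ∈ Set.Icc (3 / 4 : ℝ) 1) => ?_⟩
      obtain ⟨h0, h1⟩ := ht
      rw [key t (by linarith) (by linarith), zpow_one]
      grind

theorem hasLogSlopeAtZero_thompsonX0 : HasLogSlopeAtZero thompsonX0 (-1) := by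
  refine ⟨1 / 2, by norm_num, fun t ht => ?_⟩
  have := t.2.1
  rw [thompsonX0_apply, zpow_neg_one]
  grind

/-- The one-dimensional representation of the circle by scalar multiplication. -/
noncomputable def circleRep : Circle →* (ℂ ≃ₗᵢ[ℂ] ℂ) where
  toFun z :=
    { DistribMulAction.toLinearEquiv ℂ ℂ z with
      norm_map' := fun v => by
        change ‖z • v‖ = ‖v‖
        rw [Circle.smul_def, norm_smul, Circle.norm_coe, one_mul] }
  map_one' := by
    ext v
    exact one_smul Circle v
  map_mul' z w := by
    ext v
    exact mul_smul z w v

theorem circleRep_apply (z : Circle) (v : ℂ) : circleRep z v = z * v := rfl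

/-- Thompson's group `F` (realized as the subgroup `H` of the group of homeomorphisms of
`[0,1]`) does not have Kazhdan's property (T): for every finite `S ⊆ F` and `ε > 0` there
are a complex Hilbert space, a unitary representation `π` of `F` on it and a unit vector
`ξ` with `‖π(s)ξ − ξ‖ < ε` for all `s ∈ S`, while the only `π(F)`-fixed vector is `0`. -/
theorem thompsonF_not_kazhdan
    (H : Subgroup (Set.Icc (0:ℝ) 1 ≃ₜ Set.Icc (0:ℝ) 1))
    (hH : ∀ g, g ∈ H ↔ IsPLThompson (extIcc ⇑g)) :
    ∀ (S : Finset H) (ε : ℝ), 0 < ε →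
      ∃ (E : Type) (_ : NormedAddCommGroup E) (_ : InnerProductSpace ℂ E)
        (_ : CompleteSpace E) (π : H →* (E ≃ₗᵢ[ℂ] E)) (ξ : E),
        ‖ξ‖ = 1 ∧ (∀ s ∈ S, ‖π s ξ - ξ‖ < ε) ∧
        ∀ v : E, (∀ g : H, π g v = v) → v = 0 := by
  intro S ε hε
  have hex : ∀ g : H, ∃ k, HasLogSlopeAtZero g k := fun g =>
    HasLogSlopeAtZero.exists_of_isPLThompson ((hH g).1 g.2)
  choose φ hφ using hex
  have hmul : ∀ g h : H, φ (g * h) = φ g + φ h := fun g h =>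
    (hφ (g * h)).unique ((hφ g).mul (hφ h))
  let x₀ : H := ⟨thompsonX0, (hH _).2 isPLThompson_thompsonX0⟩
  have hx₀ : φ x₀ = -1 := (hφ x₀).unique hasLogSlopeAtZero_thompsonX0
  have hsmall : ∀ᶠ θ : ℝ in 𝓝[>] 0, ∀ s ∈ S, ‖(Circle.exp (θ * φ s) : ℂ) - 1‖ < ε := by
    refine (eventually_all_finset S).2 fun s _ => nhdsWithin_le_nhds ?_
    have hc : Continuous fun θ : ℝ => ‖(Circle.exp (θ * φ s) : ℂ) - 1‖ := by fun_prop
    exact hc.continuousAt.eventually_lt continuousAt_const (by simpa using hε)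
  obtain ⟨θ, hθS, hθ0, hθ1⟩ :=
    (hsmall.and (Ioo_mem_nhdsGT (zero_lt_one' ℝ))).exists
  let χ : H →* Circle := MonoidHom.mk' (fun g => Circle.exp (θ * φ g)) fun g h => by
    rw [hmul, Int.cast_add, mul_add, Circle.exp_add]
  refine ⟨ℂ, inferInstance, inferInstance, inferInstance, circleRep.comp χ, 1, norm_one,
    fun s hs => ?_, fun v hv => ?_⟩
  · change ‖circleRep (χ s) 1 - 1‖ < ε
    rw [circleRep_apply, mul_one]
    exact hθS s hs
  · by_contra hv0
    have h1 : (Circle.exp (θ * φ x₀) : ℂ) * v = v := hv x₀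
    have h2 : (Circle.exp (θ * φ x₀) : ℂ) = 1 := mul_right_cancel₀ hv0 (h1.trans (one_mul v).symm)
    have h3 := congrArg Complex.im h2
    rw [hx₀, Circle.coe_exp, Complex.exp_ofReal_mul_I_im] at h3
    have h4 : Real.sin θ = 0 := by simpa using h3
    exact (Real.sin_pos_of_pos_of_lt_pi hθ0 (hθ1.trans (by linarith [Real.pi_gt_three]))).ne' h4
end
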